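/- Under Assumption (A1), for every α ∈ (0,1), every subsample size s ∈ {1,…,m} and every Storey parameter s0 ∈ {0,…,n−1}, the single-subsampled adaptive procedure ASLC+ satisfies bFDR(ASLC+) ≤ α, the probability being taken marginally over both the scores and the subsampling randomization. -/

import Mathlib

open MeasureTheory Finset

noncomputable section

attribute [local instance] Classical.propDecidable

/-- The conformal p-value of test point `i` (scores are `s 1, …, s (n+m)`,
calibration scores are `s 1, …, s n`, the `i`-th test score is `s (n+i)`). -/
def pval (n : ℕ) (s : ℕ → ℝ) (i : ℕ) : ℝ :=
  (1 + (((Finset.Icc 1 n)).filter (fun j => s (n + i) ≤ s j)).card) / (n + 1)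

/-- The p-value attached to the `k`-th largest test score, with the convention
`pOrd … 0 = 0`. -/
def pOrd (n : ℕ) (s : ℕ → ℝ) (σ : ℕ → ℕ) (k : ℕ) : ℝ :=
  if k = 0 then 0 else pval n s (σ k)

/-- The largest element of `argmin_{k ∈ {0,…,m}} f k`. -/
def maxArgmin (m : ℕ) (f : ℕ → ℝ) : ℕ :=
  sSup {k | k ≤ m ∧ ∀ k' ≤ m, f k ≤ f k'}

/-- The largest element of the argmin of `f` over `{k ∈ {0,…,m} | P k}`. -/
def maxArgminOn (m : ℕ) (P : ℕ → Prop) (f : ℕ → ℝ) : ℕ :=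
  sSup {k | k ≤ m ∧ P k ∧ ∀ k' ≤ m, P k' → f k ≤ f k'}

/-- The SL (support line) index `k̂_SL` at level `α`. -/
def khatSL (n m : ℕ) (α : ℝ) (s : ℕ → ℝ) (σ : ℕ → ℕ) : ℕ :=
  maxArgmin m (fun k => pOrd n s σ k - α * k / m)

/-- The SLC (support line conformal) index `k̂_SLC` at level `α`. -/
def khatSLC (n m : ℕ) (α : ℝ) (s : ℕ → ℝ) (σ : ℕ → ℕ) : ℕ :=
  maxArgmin m (fun k => pOrd n s σ k - k * max (α / m - 1 / (n + 1)) 0)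

/-- `σ` is the permutation of `{1,…,m}` ordering the test scores decreasingly,
with the convention `σ 0 = 0`. -/
def SortsTest (n m : ℕ) (s : ℕ → ℝ) (σ : ℕ → ℕ) : Prop :=
  σ 0 = 0 ∧ Set.BijOn σ (Finset.Icc 1 m) (Finset.Icc 1 m) ∧
    ∀ k ∈ Finset.Icc 1 m, ∀ k' ∈ Finset.Icc 1 m, k < k' → s (n + σ k') < s (n + σ k)

/-- `σ'` enumerates the subsample `A ⊆ {1,…,m}` so that the corresponding test
scores are decreasing, with the convention `σ' 0 = 0`. -/
def SortsSub (n : ℕ) (s : ℕ → ℝ) (A : Finset ℕ) (σ' : ℕ → ℕ) : Prop :=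
  σ' 0 = 0 ∧ Set.BijOn σ' (Finset.Icc 1 A.card) ↑A ∧
    ∀ k ∈ Finset.Icc 1 A.card, ∀ k' ∈ Finset.Icc 1 A.card, k < k' →
      s (n + σ' k') < s (n + σ' k)

/-- The indices of the calibration scores together with the indices of the
null test scores. -/
def NullIdx (n : ℕ) (H0 : Finset ℕ) : Finset ℕ :=
  Finset.Icc 1 n ∪ H0.image (fun i => n + i)

/-- Assumption (A1), first part: the joint law of the scores is invariant under any
permutation of the coordinates indexed by `{1,…,n} ∪ {n+i : i ∈ H0}` fixing all the
other coordinates. -/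
def ExchangeableNulls {Ω : Type*} [MeasurableSpace Ω] (μ : Measure Ω)
    (n : ℕ) (H0 : Finset ℕ) (S : Ω → ℕ → ℝ) : Prop :=
  ∀ e : Equiv.Perm ℕ, (∀ j ∉ NullIdx n H0, e j = j) →
    Measure.map (fun ω => fun j => S ω (e j)) μ = Measure.map S μ

/-- The event `Ω_i`: the largest test score other than `S_{n+i}` is at least the
maximum of the calibration scores and of `S_{n+i}`. -/
def OmegaEvent {Ω : Type*} (n m : ℕ) (S : Ω → ℕ → ℝ) (i : ℕ) : Set Ω :=
  {ω | ∃ j ∈ (Finset.Icc 1 m).erase i,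
    ∀ l ∈ Finset.Icc 1 n ∪ {n + i}, S ω l ≤ S ω (n + j)}

/-- The Storey estimator `π̂₀` with parameter `s0`. -/
def storey (n m s0 : ℕ) (s : ℕ → ℝ) : ℝ :=
  (1 + (((Finset.Icc 1 m)).filter
      (fun i => ((s0 : ℝ) + 1) / (n + 1) ≤ pval n s i)).card) /
    (m * (1 - ((s0 : ℝ) + 1) / (n + 1)))

/-- The adaptive SL index `k̂_ASL` at level `α` with Storey parameter `s0`. -/
def khatASL (n m s0 : ℕ) (α : ℝ) (s : ℕ → ℝ) (σ : ℕ → ℕ) : ℕ :=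
  maxArgminOn m (fun k => pOrd n s σ k ≤ (s0 : ℝ) / (n + 1))
    (fun k => pOrd n s σ k - α * k / (m * storey n m s0 s))

/-- The adaptive SLC index `k̂_ASLC` at level `α` with Storey parameter `s0`. -/
def khatASLC (n m s0 : ℕ) (α : ℝ) (s : ℕ → ℝ) (σ : ℕ → ℕ) : ℕ :=
  maxArgmin m (fun k =>
    pOrd n s σ k - k * max (α / (m * storey n m s0 s) - 1 / (n + 1)) 0)

/-- The rejection set of the top-`k` procedure: all test points whose score is at
least the `k`-th largest one in the (sub)ordering `σ'` (empty if `k = 0`). -/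
def rejSet (n m : ℕ) (s : ℕ → ℝ) (σ' : ℕ → ℕ) (k : ℕ) : Finset ℕ :=
  if k = 0 then ∅ else (Finset.Icc 1 m).filter (fun i => s (n + σ' k) ≤ s (n + i))

/-- Probability of drawing a given subsample, for the uniform distribution over
subsets of `{1,…,m}` of cardinality `t`. -/
def subProb (m t : ℕ) (A : Finset ℕ) : ENNReal :=
  if A ∈ (Finset.Icc 1 m).powersetCard t
    then (((Finset.Icc 1 m).powersetCard t).card : ENNReal)⁻¹ else 0

/-- The `q`-th largest value among `v 0, …, v (B-1)`. -/
def kthLargest (B q : ℕ) (v : ℕ → ℕ) : ℕ :=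
  sSup {t | q ≤ ((Finset.range B).filter (fun b => t ≤ v b)).card}

/-- The adaptive subsampled index: ASLC applied to a subsample of size `t`
(enumerated by `σ'`), where the Storey estimator is computed on the full test
sample of size `m`. -/
def khatASLCsub (n m t s0 : ℕ) (α : ℝ) (s : ℕ → ℝ) (σ' : ℕ → ℕ) : ℕ :=
  maxArgminOn t (fun k => pOrd n s σ' k ≤ (s0 : ℝ) / (n + 1))
    (fun k => pOrd n s σ' k - k * max (α / (storey n m s0 s * t) - 1 / (n + 1)) 0)


/-- Number of calibration scores at least the `i`-th test score. -/
def cntC (n : ℕ) (s : ℕ → ℝ) (i : ℕ) : ℕ :=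
  ((Finset.Icc 1 n).filter (fun j => s (n + i) ≤ s j)).card

/-- Rank of test point `i` in the subsample `A`. -/
def rkC (n : ℕ) (A : Finset ℕ) (s : ℕ → ℝ) (i : ℕ) : ℕ :=
  (A.filter (fun l => s (n + i) ≤ s (n + l))).card

def lamC (n m t s0 : ℕ) (α : ℝ) (s : ℕ → ℝ) : ℝ :=
  max (α / (storey n m s0 s * t) - 1 / (n + 1)) 0

/-- `i` is at the boundary of the rejection set (up to ties). -/
def BndC (n m t s0 : ℕ) (α : ℝ) (A : Finset ℕ) (i : ℕ) (s : ℕ → ℝ) : Prop :=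
  pval n s i ≤ (s0 : ℝ) / (n + 1) ∧ pval n s i - rkC n A s i * lamC n m t s0 α s ≤ 0 ∧
    ∀ j ∈ A, pval n s j ≤ (s0 : ℝ) / (n + 1) →
      pval n s i - rkC n A s i * lamC n m t s0 α s ≤ pval n s j - rkC n A s j * lamC n m t s0 α s

/-- Storey weight. -/
def hC (n m s0 : ℕ) (i : ℕ) (s : ℕ → ℝ) : ℝ :=
  if s0 + 1 ≤ cntC n s i then
    1 / (((Finset.Icc 1 m).filter (fun j => s0 + 1 ≤ cntC n s j)).card : ℝ) else 0

lemma pval_eq (n : ℕ) (s : ℕ → ℝ) (i : ℕ) : pval n s i = (1 + (cntC n s i : ℝ)) / (n + 1) := rfl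

lemma card_sep {ι : Type*} (B : Finset ι) (G : ι → ℝ) (Λ : ℝ) (hB : B.Nonempty)
    (h1 : ∀ x ∈ B, ∀ y ∈ B, x ≠ y → 1 ≤ |G x - G y|)
    (h2 : ∀ x ∈ B, ∀ y ∈ B, G x - G y ≤ Λ) : (B.card : ℝ) ≤ 1 + Λ := by
  obtain ⟨z, hz, hmin⟩ := B.exists_min_image G hB
  have hΛ : 0 ≤ Λ := by simpa using h2 z hz z hz
  have hc : B.card ≤ (Finset.range (⌊Λ⌋₊ + 1)).card := by
    apply Finset.card_le_card_of_injOn (fun x => ⌊G x - G z⌋₊)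
    · intro x hx
      simp only [Finset.coe_range, Set.mem_Iio]
      exact Nat.lt_succ_of_le (Nat.floor_le_floor (h2 x hx z hz))
    · intro x hx y hy hxy
      by_contra hne
      have := h1 x hx y hy hne
      have hx0 : 0 ≤ G x - G z := sub_nonneg.2 (hmin x hx)
      have hy0 : 0 ≤ G y - G z := sub_nonneg.2 (hmin y hy)
      have a1 := Nat.floor_le hx0
      have a2 := Nat.lt_floor_add_one (G x - G z)
      have b1 := Nat.floor_le hy0
      have b2 := Nat.lt_floor_add_one (G y - G z)
      simp only at hxy
      rw [hxy] at a1 a2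
      have : |G x - G y| < 1 := by rw [abs_lt]; constructor <;> linarith
      linarith
  rw [Finset.card_range] at hc
  have : (B.card : ℝ) ≤ (⌊Λ⌋₊ : ℝ) + 1 := by exact_mod_cast hc
  have := Nat.floor_le hΛ
  linarith

/-- Calibration indices with the index of test point `i`. -/
def LC (n i : ℕ) : Finset ℕ := insert (n + i) (Finset.Icc 1 n)

def cC (n i : ℕ) (s : ℕ → ℝ) (x : ℝ) : ℕ := ((LC n i).filter (fun l => x ≤ s l)).card

def swC (n i l : ℕ) (s : ℕ → ℝ) : ℕ → ℝ := fun x => s (Equiv.swap l (n + i) x)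

lemma LC_card (n i : ℕ) (hi : 1 ≤ i) : (LC n i).card = n + 1 := by
  unfold LC
  rw [Finset.card_insert_of_notMem (by simp; omega)]; simp

lemma sw_self (n i l : ℕ) (s : ℕ → ℝ) : swC n i l s (n + i) = s l := by simp [swC]

lemma sw_other (n i l j : ℕ) (s : ℕ → ℝ) (hl : l ∈ LC n i) (hj : 1 ≤ j) (hji : j ≠ i) :
    swC n i l s (n + j) = s (n + j) := by
  simp only [LC, Finset.mem_insert, Finset.mem_Icc] at hl
  simp only [swC]
  rw [Equiv.swap_apply_of_ne_of_ne] <;> omega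

lemma sw_count (n i l : ℕ) (s : ℕ → ℝ) (hi : 1 ≤ i) (hl : l ∈ LC n i) (x : ℝ) :
    ((Finset.Icc 1 n).filter (fun j => x ≤ swC n i l s j)).card + (if x ≤ s l then 1 else 0)
      = cC n i s x := by
  have hmap : (LC n i).filter (fun l' => x ≤ s l')
      = ((LC n i).filter (fun j => x ≤ swC n i l s j)).map (Equiv.swap l (n + i)).toEmbedding := by
    ext y
    rw [Finset.mem_map_equiv, Finset.mem_filter, Finset.mem_filter]
    simp only [swC, Equiv.symm_swap, Equiv.swap_apply_self]
    refine and_congr_left fun _ => ?_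
    have hni : n + i ∈ LC n i := by simp [LC]
    by_cases h1 : y = l
    · subst h1; simp [hl, hni]
    by_cases h2 : y = n + i
    · subst h2; simp [hl, hni]
    rw [Equiv.swap_apply_of_ne_of_ne h1 h2]
  unfold cC
  rw [hmap, Finset.card_map]
  conv_rhs => unfold LC
  rw [Finset.filter_insert, sw_self]
  split_ifs with h
  · rw [Finset.card_insert_of_notMem]
    simp; omega
  · rfl

lemma cnt_sw_self (n i l : ℕ) (s : ℕ → ℝ) (hi : 1 ≤ i) (hl : l ∈ LC n i) :
    cntC n (swC n i l s) i + 1 = cC n i s (s l) := by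
  have := sw_count n i l s hi hl (s l)
  simpa [cntC, sw_self] using this

lemma cnt_sw_other (n i l j : ℕ) (s : ℕ → ℝ) (hi : 1 ≤ i) (hl : l ∈ LC n i) (hj : 1 ≤ j)
    (hji : j ≠ i) :
    cntC n (swC n i l s) j + (if s (n + j) ≤ s l then 1 else 0) = cC n i s (s (n + j)) := by
  have := sw_count n i l s hi hl (s (n + j))
  simpa only [cntC, sw_other n i l j s hl hj hji] using this

lemma cC_anti (n i : ℕ) (s : ℕ → ℝ) {x y : ℝ} (h : x ≤ y) : cC n i s y ≤ cC n i s x := by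
  apply Finset.card_le_card
  intro z hz
  simp only [Finset.mem_filter] at hz ⊢
  exact ⟨hz.1, h.trans hz.2⟩

lemma cC_strict (n i : ℕ) (s : ℕ → ℝ) {l : ℕ} (hl : l ∈ LC n i) {y : ℝ} (h : s l < y) :
    cC n i s y + 1 ≤ cC n i s (s l) := by
  apply Finset.card_lt_card
  rw [Finset.ssubset_iff_of_subset]
  · exact ⟨l, by simp [hl], by simp [h]⟩
  intro z hz
  simp only [Finset.mem_filter] at hz ⊢
  exact ⟨hz.1, h.le.trans hz.2⟩

/-- `1 +` the number of other test points below the threshold. -/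
def MC (n m s0 i : ℕ) (s : ℕ → ℝ) : ℕ :=
  1 + (((Finset.Icc 1 m).erase i).filter (fun j => s0 + 1 ≤ cC n i s (s (n + j)))).card

lemma storey_sw (n m s0 i l : ℕ) (s : ℕ → ℝ) (hi : i ∈ Finset.Icc 1 m) (hl : l ∈ LC n i)
    (hr : cC n i s (s l) ≤ s0) :
    storey n m s0 (swC n i l s) = MC n m s0 i s / (m * (1 - ((s0 : ℝ) + 1) / (n + 1))) := by
  have hi1 : 1 ≤ i := (Finset.mem_Icc.1 hi).1
  unfold storey MC
  congr 1
  push_cast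
  congr 3
  have hpos : (0 : ℝ) < n + 1 := by positivity
  ext j
  simp only [Finset.mem_filter, Finset.mem_erase]
  rw [pval_eq, div_le_div_iff_of_pos_right hpos]
  have e : ((s0 : ℝ) + 1 ≤ 1 + (cntC n (swC n i l s) j : ℝ)) ↔ s0 ≤ cntC n (swC n i l s) j := by
    rw [add_comm, add_le_add_iff_left]; exact_mod_cast Iff.rfl
  rw [e]
  by_cases hji : j = i
  · subst hji
    have := cnt_sw_self n j l s hi1 hl
    simp only [ne_eq, not_true_eq_false, false_and, iff_false, not_and]
    omega
  · simp only [ne_eq, hji, not_false_eq_true, true_and]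
    refine and_congr_right fun hj => ?_
    have h := cnt_sw_other n i l j s hi1 hl (Finset.mem_Icc.1 hj).1 hji
    split_ifs at h with hc
    · omega
    · have := cC_strict n i s hl (not_le.1 hc)
      omega

lemma rk_sw_self (n i l m : ℕ) (A : Finset ℕ) (hA : A ⊆ Finset.Icc 1 m) (s : ℕ → ℝ) (hiA : i ∈ A)
    (hl : l ∈ LC n i) :
    rkC n A (swC n i l s) i = ((A.erase i).filter (fun j => s l ≤ s (n + j))).card + 1 := by
  unfold rkC
  conv_lhs => rw [← Finset.insert_erase hiA]
  rw [Finset.filter_insert, if_pos le_rfl, Finset.card_insert_of_notMem (by simp)]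
  congr 2
  apply Finset.filter_congr
  intro j hj
  rw [sw_self, sw_other n i l j s hl (Finset.mem_Icc.1 (hA (Finset.mem_of_mem_erase hj))).1
    (Finset.ne_of_mem_erase hj)]

lemma rk_sw_other (n i l m j : ℕ) (A : Finset ℕ) (hA : A ⊆ Finset.Icc 1 m) (s : ℕ → ℝ)
    (hiA : i ∈ A) (hl : l ∈ LC n i) (hj : j ∈ A.erase i) :
    rkC n A (swC n i l s) j = ((A.erase i).filter (fun j' => s (n + j) ≤ s (n + j'))).card
      + (if s (n + j) ≤ s l then 1 else 0) := by
  have ho : ∀ j ∈ A.erase i, swC n i l s (n + j) = s (n + j) := fun j hj =>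
    sw_other n i l j s hl (Finset.mem_Icc.1 (hA (Finset.mem_of_mem_erase hj))).1
      (Finset.ne_of_mem_erase hj)
  unfold rkC
  conv_lhs => rw [← Finset.insert_erase hiA]
  rw [Finset.filter_insert, sw_self, ho j hj]
  have : (A.erase i).filter (fun l_1 => s (n + j) ≤ swC n i l s (n + l_1))
      = (A.erase i).filter (fun j' => s (n + j) ≤ s (n + j')) := by
    apply Finset.filter_congr
    intro j' hj'
    rw [ho j' hj']
  rw [this]
  split_ifs
  · rw [Finset.card_insert_of_notMem (by simp)]
  · rfl

/-- For injective scores, a threshold index which has test points above has a minimal one. -/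
lemma exists_min_above (n : ℕ) (A : Finset ℕ) (s : ℕ → ℝ) (x : ℝ)
    (h : 0 < (A.filter (fun j => x ≤ s (n + j))).card) :
    ∃ j ∈ A, x ≤ s (n + j) ∧ A.filter (fun j' => s (n + j) ≤ s (n + j'))
      = A.filter (fun j => x ≤ s (n + j)) := by
  obtain ⟨j, hj, hmin⟩ := Finset.exists_min_image _ (fun j => s (n + j)) (Finset.card_pos.1 h)
  simp only [Finset.mem_filter] at hj hmin
  refine ⟨j, hj.1, hj.2, ?_⟩
  ext j'
  simp only [Finset.mem_filter]
  exact ⟨fun h => ⟨h.1, hj.2.trans h.2⟩, fun h => ⟨h.1, hmin j' h⟩⟩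

section det
variable (n m t s0 : ℕ) (α : ℝ) (A : Finset ℕ) (i : ℕ) (s : ℕ → ℝ)

/-- Common value of the slope on all boundary worlds. -/
def lamW : ℝ :=
  max (α / ((MC n m s0 i s / (m * (1 - ((s0 : ℝ) + 1) / (n + 1)))) * t) - 1 / (n + 1)) 0

def FW (l : ℕ) : ℕ := ((A.erase i).filter (fun j => s l ≤ s (n + j))).card

lemma bnd_sw (hA : A ⊆ Finset.Icc 1 m) (hiA : i ∈ A) (l : ℕ) (hl : l ∈ LC n i)
    (hb : BndC n m t s0 α A i (swC n i l s)) :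
    cC n i s (s l) ≤ s0 ∧
    (cC n i s (s l) : ℝ) / (n + 1) - (FW n A i s l + 1) * lamW n m t s0 α i s ≤ 0 ∧
    ∀ j ∈ A.erase i, ∀ c k : ℕ, c ≤ s0 →
      c = cC n i s (s (n + j)) + 1 - (if s (n + j) ≤ s l then 1 else 0) →
      k = ((A.erase i).filter (fun j' => s (n + j) ≤ s (n + j'))).card
        + (if s (n + j) ≤ s l then 1 else 0) →
      (cC n i s (s l) : ℝ) / (n + 1) - (FW n A i s l + 1) * lamW n m t s0 α i s
        ≤ (c : ℝ) / (n + 1) - k * lamW n m t s0 α i s := by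
  have hpos : (0 : ℝ) < n + 1 := by positivity
  have hi := hA hiA
  have hi1 : 1 ≤ i := (Finset.mem_Icc.1 hi).1
  obtain ⟨h1, h2, h3⟩ := hb
  have hc := cnt_sw_self n i l s hi1 hl
  have hp : pval n (swC n i l s) i = (cC n i s (s l) : ℝ) / (n + 1) := by
    rw [pval_eq, ← hc]; push_cast; ring
  rw [hp] at h1 h2 h3
  have hr : cC n i s (s l) ≤ s0 := by
    rw [div_le_div_iff_of_pos_right hpos] at h1
    exact_mod_cast h1
  have hlam : lamC n m t s0 α (swC n i l s) = lamW n m t s0 α i s := by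
    unfold lamC lamW
    rw [storey_sw n m s0 i l s hi hl hr]
  have hk : (rkC n A (swC n i l s) i : ℝ) = FW n A i s l + 1 := by
    rw [rk_sw_self n i l m A hA s hiA hl]; push_cast; rfl
  rw [hlam, hk] at h2 h3
  refine ⟨hr, h2, ?_⟩
  intro j hj c k hcs hcc hkk
  have hj1 := (Finset.mem_Icc.1 (hA (Finset.mem_of_mem_erase hj))).1
  have hco := cnt_sw_other n i l j s hi1 hl hj1 (Finset.ne_of_mem_erase hj)
  have hpj : pval n (swC n i l s) j = (c : ℝ) / (n + 1) := by
    have : c = 1 + cntC n (swC n i l s) j := by omega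
    rw [pval_eq, this]; push_cast; ring
  have hkj : rkC n A (swC n i l s) j = k := by
    rw [rk_sw_other n i l m j A hA s hiA hl hj, hkk]
  have := h3 j (Finset.mem_of_mem_erase hj)
    (by rw [hpj, div_le_div_iff_of_pos_right hpos]; exact_mod_cast hcs)
  rw [hpj, hkj] at this
  exact this

lemma bnd_card (ht1 : 1 ≤ t) (hs0 : s0 + 1 ≤ n) (hm : 1 ≤ m)
    (hA : A ⊆ Finset.Icc 1 m) (hiA : i ∈ A)
    (hinj : Set.InjOn s (Finset.Icc 1 (n + m))) :
    (((LC n i).filter (fun l => BndC n m t s0 α A i (swC n i l s))).card : ℝ)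
      ≤ max (α * m * (n - s0) / (MC n m s0 i s * t)) 0 := by
  set B := (LC n i).filter (fun l => BndC n m t s0 α A i (swC n i l s)) with hBdef
  have hpos : (0 : ℝ) < n + 1 := by positivity
  have hi := hA hiA
  have him := Finset.mem_Icc.1 hi
  rcases B.eq_empty_or_nonempty with hBe | hBn
  · rw [hBe]; simp
  refine le_trans ?_ (le_max_left _ _)
  have hB : ∀ l ∈ B, l ∈ LC n i ∧ BndC n m t s0 α A i (swC n i l s) := fun l hl => by
    simpa [hBdef] using hl
  have hLr : ∀ l ∈ LC n i, l ∈ (Finset.Icc 1 (n + m) : Finset ℕ) := by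
    intro l hl
    simp only [LC, Finset.mem_insert, Finset.mem_Icc] at hl ⊢
    omega
  set lam := lamW n m t s0 α i s with hlamdef
  have hlam0 : 0 ≤ lam := le_max_right _ _
  have hcpos : ∀ l ∈ LC n i, 1 ≤ cC n i s (s l) := by
    intro l hl
    apply Finset.card_pos.2
    exact ⟨l, by simp [hl]⟩
  have hne : ∀ l ∈ LC n i, ∀ j ∈ A.erase i, s l ≠ s (n + j) := by
    intro l hl j hj heq
    have hjA := Finset.mem_Icc.1 (hA (Finset.mem_of_mem_erase hj))
    have hji := Finset.ne_of_mem_erase hj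
    have := hinj (hLr l hl) (by simp; omega) heq
    simp only [LC, Finset.mem_insert, Finset.mem_Icc] at hl
    omega
  have hlampos : 0 < lam := by
    obtain ⟨l, hl⟩ := hBn
    obtain ⟨hl, hb⟩ := hB l hl
    obtain ⟨-, h2, -⟩ := bnd_sw n m t s0 α A i s hA hiA l hl hb
    have : (0 : ℝ) < (cC n i s (s l) : ℝ) / (n + 1) := by
      have := hcpos l hl
      positivity
    rcases hlam0.lt_or_eq with h | h
    · exact h
    · rw [← hlamdef, ← h] at h2; simp only [mul_zero, sub_zero] at h2; linarith
  let g : ℕ → ℝ := fun l => (cC n i s (s l) : ℝ) / (n + 1) - (FW n A i s l + 1) * lam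
  have key1 : ∀ l ∈ B, ∀ l' ∈ B, s l' < s l → g l ≤ g l' - 1 / (n + 1) := by
    intro l hlB l' hlB' hlt
    obtain ⟨hl, hb⟩ := hB l hlB
    obtain ⟨hl', hb'⟩ := hB l' hlB'
    obtain ⟨h1, h2, h3⟩ := bnd_sw n m t s0 α A i s hA hiA l hl hb
    obtain ⟨h1', h2', h3'⟩ := bnd_sw n m t s0 α A i s hA hiA l' hl' hb'
    have hcs := cC_strict n i s hl' hlt
    have hcsR : (cC n i s (s l) : ℝ) / (n + 1) ≤ (cC n i s (s l') : ℝ) / (n + 1) - 1 / (n + 1) := by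
      rw [← sub_div, div_le_div_iff_of_pos_right hpos]
      have : (cC n i s (s l) : ℝ) + 1 ≤ cC n i s (s l') := by exact_mod_cast hcs
      linarith
    by_cases hF : FW n A i s l' ≤ FW n A i s l
    · have : (FW n A i s l' : ℝ) ≤ FW n A i s l := by exact_mod_cast hF
      have := mul_le_mul_of_nonneg_right this hlam0
      simp only [g]
      linarith
    · obtain ⟨j, hj, hxj, heq⟩ := exists_min_above n (A.erase i) s (s l')
        (by have : 0 < FW n A i s l' := by omega
            exact this)
      have hjl : s (n + j) ≤ s l := by
        by_contra hcon
        apply hF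
        apply Finset.card_le_card
        rw [← heq]
        intro z hz
        simp only [Finset.mem_filter] at hz ⊢
        exact ⟨hz.1, (not_le.1 hcon).le.trans hz.2⟩
      have hxj' : s l' < s (n + j) := lt_of_le_of_ne hxj (hne l' hl' j hj)
      have hcj := cC_strict n i s hl' hxj'
      have := h3 j hj (cC n i s (s (n + j))) (FW n A i s l' + 1) (by omega)
        (by rw [if_pos hjl]; omega) (by rw [if_pos hjl, heq]; rfl)
      have hcjR : (cC n i s (s (n + j)) : ℝ) / (n + 1)
          ≤ (cC n i s (s l') : ℝ) / (n + 1) - 1 / (n + 1) := by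
        rw [← sub_div, div_le_div_iff_of_pos_right hpos]
        have : (cC n i s (s (n + j)) : ℝ) + 1 ≤ cC n i s (s l') := by exact_mod_cast hcj
        linarith
      push_cast at this
      simp only [g]
      linarith
  have key2 : ∀ l ∈ B, ∀ l' ∈ B, s l' < s l → g l' ≤ g l + lam := by
    intro l hlB l' hlB' hlt
    obtain ⟨hl, hb⟩ := hB l hlB
    obtain ⟨hl', hb'⟩ := hB l' hlB'
    obtain ⟨h1, h2, h3⟩ := bnd_sw n m t s0 α A i s hA hiA l hl hb
    obtain ⟨h1', h2', h3'⟩ := bnd_sw n m t s0 α A i s hA hiA l' hl' hb'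
    by_cases hF : FW n A i s l = 0
    · have : (0 : ℝ) ≤ (cC n i s (s l) : ℝ) / (n + 1) := by positivity
      simp only [g, hF]
      push_cast
      linarith
    · obtain ⟨j, hj, hxj, heq⟩ := exists_min_above n (A.erase i) s (s l)
        (Nat.pos_of_ne_zero hF)
      have hxj' : s l < s (n + j) := lt_of_le_of_ne hxj (hne l hl j hj)
      have hcj := cC_strict n i s hl hxj'
      have hn' : ¬ s (n + j) ≤ s l' := not_le.2 (hlt.trans hxj')
      have := h3' j hj (cC n i s (s (n + j)) + 1) (FW n A i s l) (by omega)
        (by rw [if_neg hn']; omega) (by rw [if_neg hn', heq]; rfl)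
      have hcjR : ((cC n i s (s (n + j)) + 1 : ℕ) : ℝ) / (n + 1)
          ≤ (cC n i s (s l) : ℝ) / (n + 1) := by
        rw [div_le_div_iff_of_pos_right hpos]
        exact_mod_cast hcj
      simp only [g]
      linarith
  have hcard := card_sep B (fun l => (n + 1) * g l) ((n + 1) * lam) hBn (by
      intro x hx y hy hxy
      have hsne : s x ≠ s y := fun h => hxy (hinj (hLr x (hB x hx).1) (hLr y (hB y hy).1) h)
      rw [← mul_sub, abs_mul, abs_of_pos hpos]
      have : 1 / ((n : ℝ) + 1) ≤ |g x - g y| := by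
        rcases lt_or_gt_of_ne hsne with h | h
        · have := key1 y hy x hx h
          exact le_trans (by linarith) (le_abs_self _)
        · have := key1 x hx y hy h
          rw [abs_sub_comm]
          exact le_trans (by linarith) (le_abs_self _)
      rw [div_le_iff₀ hpos] at this
      linarith) (by
      intro x hx y hy
      rw [← mul_sub]
      apply mul_le_mul_of_nonneg_left _ hpos.le
      have hpos' : 0 < 1 / ((n : ℝ) + 1) := by positivity
      rcases lt_trichotomy (s x) (s y) with h | h | h
      · linarith [key2 y hy x hx h]
      · have : x = y := hinj (hLr x (hB x hx).1) (hLr y (hB y hy).1) h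
        subst this; linarith
      · linarith [key1 x hx y hy h])
  refine hcard.trans (le_of_eq ?_)
  have hlamE : lam = α / ((MC n m s0 i s / (m * (1 - ((s0 : ℝ) + 1) / (n + 1)))) * t)
      - 1 / (n + 1) := by
    rw [hlamdef]; unfold lamW
    apply max_eq_left
    by_contra hcon
    rw [hlamdef] at hlampos; unfold lamW at hlampos
    rw [max_eq_right (not_le.1 hcon).le] at hlampos
    exact lt_irrefl _ hlampos
  rw [hlamE]
  have hM : (0 : ℝ) < MC n m s0 i s := by
    have : 0 < MC n m s0 i s := by unfold MC; omega
    exact_mod_cast this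
  have hmR : (0 : ℝ) < m := by exact_mod_cast hm
  have htR : (0 : ℝ) < t := by exact_mod_cast ht1
  have hns : (0 : ℝ) < n - s0 := by
    have : (s0 : ℝ) + 1 ≤ n := by exact_mod_cast hs0
    linarith
  have hq : (1 - ((s0 : ℝ) + 1) / (n + 1)) = (n - s0) / (n + 1) := by field_simp; ring
  rw [hq]
  field_simp
  ring

lemma h_sum (hs0 : s0 + 1 ≤ n) (hi : i ∈ Finset.Icc 1 m)
    (hinj : Set.InjOn s (Finset.Icc 1 (n + m))) :
    ((n : ℝ) - s0) / MC n m s0 i s ≤ ∑ l ∈ LC n i, hC n m s0 i (swC n i l s) := by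
  have him := Finset.mem_Icc.1 hi
  have hLr : ∀ l ∈ LC n i, l ∈ (Finset.Icc 1 (n + m) : Finset ℕ) := by
    intro l hl
    simp only [LC, Finset.mem_insert, Finset.mem_Icc] at hl ⊢
    omega
  set T := (LC n i).filter (fun l => s0 + 2 ≤ cC n i s (s l)) with hT
  have hcard : n - s0 ≤ T.card := by
    have h1 : ((LC n i).filter (fun l => ¬ s0 + 2 ≤ cC n i s (s l))).card
        ≤ (Finset.Icc 1 (s0 + 1)).card := by
      apply Finset.card_le_card_of_injOn (fun l => cC n i s (s l))
      · intro l hl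
        simp only [Finset.coe_filter, Set.mem_ofPred_eq, Finset.coe_Icc, Set.mem_Icc] at hl ⊢
        have : 0 < cC n i s (s l) := Finset.card_pos.2 ⟨l, by simp [hl.1]⟩
        omega
      · intro x hx y hy hxy
        simp only [Finset.coe_filter, Set.mem_ofPred_eq] at hx hy hxy
        rcases lt_trichotomy (s x) (s y) with h | h | h
        · have := cC_strict n i s hx.1 h; omega
        · exact hinj (hLr x hx.1) (hLr y hy.1) h
        · have := cC_strict n i s hy.1 h; omega
    have h2 := Finset.card_filter_add_card_filter_not (s := LC n i)
      (fun l => s0 + 2 ≤ cC n i s (s l))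
    rw [LC_card n i him.1, ← hT] at h2
    rw [Nat.card_Icc] at h1
    omega
  have hM : (0 : ℝ) < MC n m s0 i s := by
    have : 0 < MC n m s0 i s := by unfold MC; omega
    exact_mod_cast this
  have hterm : ∀ l ∈ T, 1 / (MC n m s0 i s : ℝ) ≤ hC n m s0 i (swC n i l s) := by
    intro l hl
    simp only [hT, Finset.mem_filter] at hl
    have hc := cnt_sw_self n i l s him.1 hl.1
    have hcc : s0 + 1 ≤ cntC n (swC n i l s) i := by omega
    unfold hC
    rw [if_pos hcc]
    apply one_div_le_one_div_of_le
    · have : 0 < ((Finset.Icc 1 m).filter (fun j => s0 + 1 ≤ cntC n (swC n i l s) j)).card :=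
        Finset.card_pos.2 ⟨i, by simp only [Finset.mem_filter]; exact ⟨hi, hcc⟩⟩
      exact_mod_cast this
    · have : ((Finset.Icc 1 m).filter (fun j => s0 + 1 ≤ cntC n (swC n i l s) j)).card
          ≤ MC n m s0 i s := by
        unfold MC
        rw [Nat.add_comm 1 (Finset.card _)]
        refine le_trans (Finset.card_le_card ?_) (Finset.card_insert_le i _)
        intro j hj
        simp only [Finset.mem_filter, Finset.mem_insert, Finset.mem_erase] at hj ⊢
        by_cases hji : j = i
        · exact Or.inl hji
        · refine Or.inr ⟨⟨hji, hj.1⟩, ?_⟩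
          have := cnt_sw_other n i l j s him.1 hl.1 (Finset.mem_Icc.1 hj.1).1 hji
          omega
      exact_mod_cast this
  calc ((n : ℝ) - s0) / MC n m s0 i s ≤ T.card * (1 / (MC n m s0 i s : ℝ)) := by
        rw [mul_one_div]
        apply div_le_div_of_nonneg_right _ hM.le
        have : n ≤ T.card + s0 := by omega
        have : (n : ℝ) ≤ T.card + s0 := by exact_mod_cast this
        linarith
    _ = ∑ l ∈ T, (1 / (MC n m s0 i s : ℝ)) := by simp
    _ ≤ ∑ l ∈ T, hC n m s0 i (swC n i l s) := Finset.sum_le_sum hterm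
    _ ≤ _ := by
        apply Finset.sum_le_sum_of_subset_of_nonneg (Finset.filter_subset _ _)
        intro l _ _
        unfold hC
        split_ifs <;> positivity

lemma det_main (ht1 : 1 ≤ t) (hs0 : s0 + 1 ≤ n) (hm : 1 ≤ m) (hα : 0 < α)
    (hA : A ⊆ Finset.Icc 1 m) (hiA : i ∈ A)
    (hinj : Set.InjOn s (Finset.Icc 1 (n + m))) :
    (((LC n i).filter (fun l => BndC n m t s0 α A i (swC n i l s))).card : ℝ)
      ≤ ∑ l ∈ LC n i, (α * m / t) * hC n m s0 i (swC n i l s) := by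
  refine (bnd_card n m t s0 α A i s ht1 hs0 hm hA hiA hinj).trans ?_
  rw [← Finset.mul_sum]
  have h := h_sum n m s0 i s hs0 (hA hiA) hinj
  have hk : 0 ≤ α * m / t := by positivity
  have hns : (0 : ℝ) ≤ n - s0 := by
    have : (s0 : ℝ) + 1 ≤ n := by exact_mod_cast hs0
    linarith
  have h' := mul_le_mul_of_nonneg_left h hk
  have e : α * m / t * (((n : ℝ) - s0) / MC n m s0 i s)
      = α * m * (n - s0) / (MC n m s0 i s * t) := by
    rw [div_mul_div_comm, mul_comm (t : ℝ)]
  rw [e] at h'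
  apply max_le h'
  refine le_trans ?_ h'
  positivity

end det

lemma meas_card_le (F : Finset ℕ) (a : ℕ) (b : ℕ → ℕ) :
    Measurable (fun s : ℕ → ℝ => (F.filter (fun j => s a ≤ s (b j))).card) := by
  simp only [Finset.card_filter]
  refine Finset.measurable_sum _ fun j _ => ?_
  exact Measurable.ite (measurableSet_le (measurable_pi_apply a) (measurable_pi_apply (b j)))
    measurable_const measurable_const

lemma meas_cnt (n i : ℕ) : Measurable (fun s : ℕ → ℝ => cntC n s i) :=
  meas_card_le (Finset.Icc 1 n) (n + i) (fun j => j)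

lemma meas_rk (n : ℕ) (A : Finset ℕ) (i : ℕ) : Measurable (fun s : ℕ → ℝ => (rkC n A s i : ℝ)) :=
  (measurable_of_countable (fun k : ℕ => (k : ℝ))).comp (meas_card_le A (n + i) (fun j => n + j))

lemma meas_pval (n i : ℕ) : Measurable (fun s : ℕ → ℝ => pval n s i) :=
  (measurable_of_countable (fun k : ℕ => (1 + (k : ℝ)) / (n + 1))).comp (meas_cnt n i)

lemma meas_storey (n m s0 : ℕ) : Measurable (fun s : ℕ → ℝ => storey n m s0 s) := by
  have h : Measurable (fun s : ℕ → ℝ => ((Finset.Icc 1 m).filter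
      (fun i => ((s0 : ℝ) + 1) / (n + 1) ≤ pval n s i)).card) := by
    simp only [Finset.card_filter]
    refine Finset.measurable_sum _ fun j _ => ?_
    exact Measurable.ite (measurableSet_le measurable_const (meas_pval n j))
      measurable_const measurable_const
  exact (measurable_of_countable
    (fun k : ℕ => (1 + (k : ℝ)) / (m * (1 - ((s0 : ℝ) + 1) / (n + 1))))).comp h

lemma meas_lam (n m t s0 : ℕ) (α : ℝ) : Measurable (fun s : ℕ → ℝ => lamC n m t s0 α s) := by
  unfold lamC
  have := meas_storey n m s0
  fun_prop

lemma meas_h (n m s0 i : ℕ) : Measurable (fun s : ℕ → ℝ => hC n m s0 i s) := by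
  have h : Measurable (fun s : ℕ → ℝ => ((Finset.Icc 1 m).filter
      (fun j => s0 + 1 ≤ cntC n s j)).card) := by
    simp only [Finset.card_filter]
    refine Finset.measurable_sum _ fun j _ => ?_
    exact Measurable.ite (measurableSet_le measurable_const (meas_cnt n j))
      measurable_const measurable_const
  unfold hC
  exact Measurable.ite (measurableSet_le measurable_const (meas_cnt n i))
    ((measurable_of_countable (fun k : ℕ => 1 / (k : ℝ))).comp h) measurable_const

lemma meas_bnd (n m t s0 : ℕ) (α : ℝ) (A : Finset ℕ) (i : ℕ) :
    MeasurableSet {s : ℕ → ℝ | BndC n m t s0 α A i s} := by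
  have hl := meas_lam n m t s0 α
  have hg : ∀ j, Measurable (fun s : ℕ → ℝ => pval n s j - rkC n A s j * lamC n m t s0 α s) :=
    fun j => (meas_pval n j).sub ((meas_rk n A j).mul hl)
  unfold BndC
  refine (measurableSet_le (meas_pval n i) measurable_const).inter
    ((measurableSet_le (hg i) measurable_const).inter ?_)
  have : {s : ℕ → ℝ | ∀ j ∈ A, pval n s j ≤ (s0 : ℝ) / (n + 1) →
      pval n s i - rkC n A s i * lamC n m t s0 α s ≤ pval n s j - rkC n A s j * lamC n m t s0 α s}
      = ⋂ j ∈ A, ({s | pval n s j ≤ (s0 : ℝ) / (n + 1)}ᶜ ∪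
        {s | pval n s i - rkC n A s i * lamC n m t s0 α s
          ≤ pval n s j - rkC n A s j * lamC n m t s0 α s}) := by
    ext s
    simp only [Set.mem_iInter, Set.mem_union, Set.mem_compl_iff, Set.mem_ofPred_eq]
    exact forall_congr' fun j => forall_congr' fun _ => imp_iff_not_or
  refine (congrArg MeasurableSet this).mpr ?_
  refine Finset.measurableSet_biInter A fun j _ => ?_
  exact (measurableSet_le (meas_pval n j) measurable_const).compl.union
    (measurableSet_le (hg i) (hg j))

lemma symm_lint {Ω : Type*} [MeasurableSpace Ω] (μ : Measure Ω) (n m : ℕ)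
    (S : Ω → ℕ → ℝ) (hS : Measurable S) (H0 : Finset ℕ) (hH0 : H0 ⊆ Finset.Icc 1 m)
    (hexch : ExchangeableNulls μ n H0 S) (i : ℕ) (hi : i ∈ H0)
    (f g : (ℕ → ℝ) → ENNReal) (hf : Measurable f) (hg : Measurable g)
    (h : ∀ᵐ ω ∂μ, ∑ l ∈ LC n i, f (swC n i l (S ω)) ≤ ∑ l ∈ LC n i, g (swC n i l (S ω))) :
    ∫⁻ ω, f (S ω) ∂μ ≤ ∫⁻ ω, g (S ω) ∂μ := by
  have hi1 : 1 ≤ i := (Finset.mem_Icc.1 (hH0 hi)).1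
  have hSw : ∀ l, Measurable (fun ω => swC n i l (S ω)) := by
    intro l
    refine measurable_pi_lambda _ fun j => ?_
    exact (measurable_pi_apply _).comp hS
  have hone : ∀ (f : (ℕ → ℝ) → ENNReal), Measurable f → ∀ l ∈ LC n i,
      ∫⁻ ω, f (swC n i l (S ω)) ∂μ = ∫⁻ ω, f (S ω) ∂μ := by
    intro f hf l hl
    have := hexch (Equiv.swap l (n + i)) (by
      intro j hj
      simp only [LC, NullIdx, Finset.mem_insert, Finset.mem_union, Finset.mem_image,
        not_or, Finset.mem_Icc] at hl hj
      apply Equiv.swap_apply_of_ne_of_ne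
      · rintro rfl
        rcases hl with hl | hl
        · exact hj.2 ⟨i, hi, hl.symm⟩
        · exact hj.1 hl
      · rintro rfl
        exact hj.2 ⟨i, hi, rfl⟩)
    rw [← lintegral_map hf (hSw l), ← lintegral_map hf hS]
    exact congrArg (fun ν => ∫⁻ a, f a ∂ν) this
  have hsum : ∀ (f : (ℕ → ℝ) → ENNReal), Measurable f →
      ∫⁻ ω, ∑ l ∈ LC n i, f (swC n i l (S ω)) ∂μ = (n + 1 : ℕ) * ∫⁻ ω, f (S ω) ∂μ := by
    intro f hf
    rw [lintegral_finsetSum (f := fun l ω => f (swC n i l (S ω))) _ (fun l _ => hf.comp (hSw l)),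
      Finset.sum_congr rfl (hone f hf),
      Finset.sum_const, LC_card n i hi1, nsmul_eq_mul]
  have := lintegral_mono_ae h
  rw [hsum f hf, hsum g hg] at this
  exact (ENNReal.mul_le_mul_iff_right (by simp) (by simp)).1 this

lemma rank_of_sorted (n : ℕ) (s : ℕ → ℝ) (A : Finset ℕ) (N : ℕ) (σ : ℕ → ℕ)
    (hb : Set.BijOn σ (Finset.Icc 1 N) ↑A)
    (hd : ∀ k ∈ Finset.Icc 1 N, ∀ k' ∈ Finset.Icc 1 N, k < k' → s (n + σ k') < s (n + σ k))
    (k : ℕ) (hk : k ∈ Finset.Icc 1 N) : rkC n A s (σ k) = k := by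
  unfold rkC
  have : A.filter (fun l => s (n + σ k) ≤ s (n + l)) = (Finset.Icc 1 k).image σ := by
    ext l
    simp only [Finset.mem_filter, Finset.mem_image]
    have hkN := Finset.mem_Icc.1 hk
    constructor
    · rintro ⟨hl, hle⟩
      obtain ⟨q, hq, rfl⟩ := hb.surjOn hl
      refine ⟨q, ?_, rfl⟩
      have hqN := Finset.mem_Icc.1 hq
      rw [Finset.mem_Icc]
      refine ⟨hqN.1, ?_⟩
      by_contra hcon
      exact absurd (hd k hk q hq (not_le.1 hcon)) (not_lt.2 hle)
    · rintro ⟨q, hq, rfl⟩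
      rw [Finset.mem_Icc] at hq
      have hqN : q ∈ Finset.Icc 1 N := Finset.mem_Icc.2 ⟨hq.1, hq.2.trans hkN.2⟩
      refine ⟨hb.mapsTo hqN, ?_⟩
      rcases hq.2.lt_or_eq with h | h
      · exact (hd q hqN k hk h).le
      · rw [h]
  rw [this, Finset.card_image_of_injOn]
  · simp
  · apply hb.injOn.mono
    intro q hq
    simp only [Finset.coe_Icc, Set.mem_Icc, Finset.mem_Icc] at hq hk ⊢
    omega

lemma link (n m t s0 : ℕ) (α : ℝ) (s : ℕ → ℝ) (A H0 : Finset ℕ) (hA : A ⊆ Finset.Icc 1 m)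
    (hAt : A.card = t) (σ σ' : ℕ → ℕ) (hσ : SortsTest n m s σ) (hσ' : SortsSub n s A σ')
    (hne : rejSet n m s σ' (khatASLCsub n m t s0 α s σ') ≠ ∅)
    (hH : σ (rejSet n m s σ' (khatASLCsub n m t s0 α s σ')).card ∈ H0) :
    ∃ i ∈ A ∩ H0, BndC n m t s0 α A i s := by
  set k := khatASLCsub n m t s0 α s σ' with hk
  have hk0 : k ≠ 0 := by
    intro h; apply hne; simp [rejSet, h]
  obtain ⟨-, hb', hd'⟩ := hσ'
  rw [hAt] at hb' hd'
  have hmem : k ≤ t ∧ pOrd n s σ' k ≤ (s0 : ℝ) / (n + 1) ∧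
      ∀ k' ≤ t, pOrd n s σ' k' ≤ (s0 : ℝ) / (n + 1) →
        pOrd n s σ' k - k * lamC n m t s0 α s ≤ pOrd n s σ' k' - k' * lamC n m t s0 α s := by
    have hbdd : BddAbove {k | k ≤ t ∧ pOrd n s σ' k ≤ (s0 : ℝ) / (n + 1) ∧
      ∀ k' ≤ t, pOrd n s σ' k' ≤ (s0 : ℝ) / (n + 1) →
        pOrd n s σ' k - k * lamC n m t s0 α s ≤ pOrd n s σ' k' - k' * lamC n m t s0 α s} :=
      ⟨t, fun x hx => hx.1⟩
    refine Nat.sSup_mem ?_ hbdd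
    obtain ⟨z, hz, hmin⟩ := Finset.exists_min_image
      ((Finset.range (t + 1)).filter (fun k => pOrd n s σ' k ≤ (s0 : ℝ) / (n + 1)))
      (fun k => pOrd n s σ' k - k * lamC n m t s0 α s)
      ⟨0, Finset.mem_filter.2 ⟨by simp, by simp only [pOrd, if_true]; positivity⟩⟩
    simp only [Finset.mem_filter, Finset.mem_range] at hz hmin
    exact ⟨z, by omega, hz.2, fun k' h1 h2 => hmin k' ⟨by omega, h2⟩⟩
  obtain ⟨hkt, hkp, hkm⟩ := hmem
  have hkI : k ∈ Finset.Icc 1 t := Finset.mem_Icc.2 ⟨by omega, hkt⟩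
  have hiA : σ' k ∈ A := hb'.mapsTo hkI
  have hpk : pOrd n s σ' k = pval n s (σ' k) := by simp [pOrd, hk0]
  have hrk := rank_of_sorted n s A t σ' hb' hd' k hkI
  refine ⟨σ' k, Finset.mem_inter.2 ⟨hiA, ?_⟩, ?_, ?_, ?_⟩
  · obtain ⟨-, hb, hd⟩ := hσ
    obtain ⟨q, hq, hqe⟩ := hb.surjOn (hA hiA)
    have h1 := rank_of_sorted n s (Finset.Icc 1 m) m σ hb hd q hq
    have h2 : (rejSet n m s σ' k).card = q := by
      rw [← h1, hqe]; simp [rejSet, hk0, rkC]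
    rw [h2, hqe] at hH
    exact hH
  · rw [← hpk]; exact hkp
  · have := hkm 0 (by omega) (by simp only [pOrd, if_true]; positivity)
    rw [hrk, ← hpk]
    simpa [pOrd] using this
  · intro j hj hjp
    obtain ⟨q, hq, rfl⟩ := hb'.surjOn hj
    have hq' := Finset.mem_Icc.1 hq
    have hq0 : q ≠ 0 := by omega
    have hpq : pOrd n s σ' q = pval n s (σ' q) := by simp [pOrd, hq0]
    rw [rank_of_sorted n s A t σ' hb' hd' q hq, hrk, ← hpk, ← hpq]
    exact hkm q hq'.2 (by rw [hpq]; exact hjp)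

lemma bnd_prob {Ω : Type*} [MeasurableSpace Ω] (μ : Measure Ω)
    (n m t s0 : ℕ) (hm : 1 ≤ m) (α : ℝ) (hα : 0 < α) (ht1 : 1 ≤ t) (hs0 : s0 + 1 ≤ n)
    (S : Ω → ℕ → ℝ) (hS : Measurable S) (H0 : Finset ℕ) (hH0 : H0 ⊆ Finset.Icc 1 m)
    (hexch : ExchangeableNulls μ n H0 S)
    (hdist : ∀ᵐ ω ∂μ, Set.InjOn (S ω) (Finset.Icc 1 (n + m)))
    (A : Finset ℕ) (hA : A ⊆ Finset.Icc 1 m) (i : ℕ) (hiA : i ∈ A) (hi : i ∈ H0) :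
    μ (S ⁻¹' {s | BndC n m t s0 α A i s})
      ≤ ENNReal.ofReal (α * m / t) * ∫⁻ ω, ENNReal.ofReal (hC n m s0 i (S ω)) ∂μ := by
  have hmb := meas_bnd n m t s0 α A i
  have hmh := (meas_h n m s0 i).ennreal_ofReal
  have h := symm_lint μ n m S hS H0 hH0 hexch i hi
    ({s | BndC n m t s0 α A i s}.indicator 1)
    (fun s => ENNReal.ofReal (α * m / t) * ENNReal.ofReal (hC n m s0 i s))
    (measurable_one.indicator hmb) (hmh.const_mul _) (by
      filter_upwards [hdist] with ω hω
      have hd := det_main n m t s0 α A i (S ω) ht1 hs0 hm hα hA hiA hω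
      have hk : 0 ≤ α * m / t := by positivity
      have hh : ∀ s, 0 ≤ hC n m s0 i s := by
        intro s; unfold hC; split_ifs <;> positivity
      simp only [← ENNReal.ofReal_mul hk]
      rw [← ENNReal.ofReal_sum_of_nonneg (fun l _ => mul_nonneg hk (hh _))]
      refine le_trans (le_of_eq ?_) (ENNReal.ofReal_le_ofReal hd)
      rw [ENNReal.ofReal_natCast, Finset.card_filter, Nat.cast_sum]
      refine Finset.sum_congr rfl fun l _ => ?_
      simp only [Set.indicator_apply, Set.mem_ofPred_eq, Pi.one_apply]
      split_ifs <;> simp)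
  rw [lintegral_const_mul (f := fun ω => ENNReal.ofReal (hC n m s0 i (S ω))) _ (hmh.comp hS)] at h
  refine le_trans (le_of_eq ?_) h
  rw [← lintegral_indicator_one (hS hmb)]
  rfl

lemma h_total (n m s0 : ℕ) (H0 : Finset ℕ) (hH0 : H0 ⊆ Finset.Icc 1 m) (s : ℕ → ℝ) :
    ∑ i ∈ H0, ENNReal.ofReal (hC n m s0 i s) ≤ 1 := by
  have hh : ∀ i, 0 ≤ hC n m s0 i s := by
    intro i; unfold hC; split_ifs <;> positivity
  rw [← ENNReal.ofReal_sum_of_nonneg (fun i _ => hh i), ENNReal.ofReal_le_one]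
  refine (Finset.sum_le_sum_of_subset_of_nonneg hH0 (fun i _ _ => hh i)).trans ?_
  unfold hC
  rw [← Finset.sum_filter, Finset.sum_const, nsmul_eq_mul, mul_one_div]
  exact div_self_le_one _

lemma count_sub (m t i : ℕ) (ht1 : 1 ≤ t) (hi : i ∈ Finset.Icc 1 m) :
    m * (((Finset.Icc 1 m).powersetCard t).filter (fun A => i ∈ A)).card
      = t * ((Finset.Icc 1 m).powersetCard t).card := by
  obtain ⟨t, rfl⟩ : ∃ u, t = u + 1 := ⟨t - 1, by omega⟩
  have him := Finset.mem_Icc.1 hi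
  obtain ⟨m, rfl⟩ : ∃ u, m = u + 1 := ⟨m - 1, by omega⟩
  have : (((Finset.Icc 1 (m + 1)).powersetCard (t + 1)).filter (fun A => i ∈ A)).card
      = (((Finset.Icc 1 (m + 1)).erase i).powersetCard t).card := by
    symm
    apply Finset.card_bij (fun B _ => insert i B)
    · intro B hB
      rw [Finset.mem_powersetCard] at hB
      simp only [Finset.mem_filter, Finset.mem_powersetCard]
      have hiB : i ∉ B := fun h => by simpa using hB.1 h
      refine ⟨⟨Finset.insert_subset hi (hB.1.trans (Finset.erase_subset _ _)), ?_⟩, by simp⟩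
      rw [Finset.card_insert_of_notMem hiB, hB.2]
    · intro B hB B' hB' h
      rw [Finset.mem_powersetCard] at hB hB'
      have hiB : i ∉ B := fun h => by simpa using hB.1 h
      have hiB' : i ∉ B' := fun h => by simpa using hB'.1 h
      rw [← Finset.erase_insert hiB, h, Finset.erase_insert hiB']
    · intro A hA
      simp only [Finset.mem_filter, Finset.mem_powersetCard] at hA
      refine ⟨A.erase i, ?_, Finset.insert_erase hA.2⟩
      rw [Finset.mem_powersetCard, Finset.card_erase_of_mem hA.2]
      exact ⟨Finset.erase_subset_erase _ hA.1.1, by omega⟩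
  rw [this, Finset.card_powersetCard, Finset.card_powersetCard, Finset.card_erase_of_mem hi,
    Nat.card_Icc]
  simp only [Nat.add_sub_cancel]
  rw [Nat.add_one_mul_choose_eq, mul_comm]

/-- Theorem 3.10 of the paper, first part: under Assumption
(A1), the single-subsampled adaptive procedure ASLC+ at level `α ∈ (0,1)`, with
subsample size `t ∈ {1,…,m}` and Storey parameter `s0 ∈ {0,…,n-1}` (computed on
the full test sample), satisfies `bFDR(ASLC+) ≤ α`, the probability being taken
marginally over both the scores and the subsampling randomization. -/
theorem ASLCplus_bFDR_control
    {Ω : Type*} [MeasurableSpace Ω] (μ : Measure Ω) [IsProbabilityMeasure μ]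
    (n m : ℕ) (hn : 1 ≤ n) (hm : 1 ≤ m)
    (α : ℝ) (hα : α ∈ Set.Ioo (0 : ℝ) 1)
    (t : ℕ) (ht1 : 1 ≤ t) (htm : t ≤ m)
    (s0 : ℕ) (hs0 : s0 ≤ n - 1)
    (S : Ω → ℕ → ℝ) (hS : Measurable S)
    (H0 : Finset ℕ) (hH0 : H0 ⊆ Finset.Icc 1 m)
    (hexch : ExchangeableNulls μ n H0 S)
    (hdist : ∀ᵐ ω ∂μ, Set.InjOn (S ω) (Finset.Icc 1 (n + m)))
    (σ : Ω → ℕ → ℕ) (hσ : ∀ᵐ ω ∂μ, SortsTest n m (S ω) (σ ω))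
    (𝒮 : Ω → Finset ℕ)
    (hsub : ∀ (A : Finset ℕ) (E : Set (ℕ → ℝ)), MeasurableSet E →
      μ ({ω | 𝒮 ω = A} ∩ S ⁻¹' E) = subProb m t A * μ (S ⁻¹' E))
    (σ' : Ω → ℕ → ℕ) (hσ' : ∀ᵐ ω ∂μ, SortsSub n (S ω) (𝒮 ω) (σ' ω)) :
    μ {ω | rejSet n m (S ω) (σ' ω) (khatASLCsub n m t s0 α (S ω) (σ' ω)) ≠ ∅
          ∧ σ ω (rejSet n m (S ω) (σ' ω)
              (khatASLCsub n m t s0 α (S ω) (σ' ω))).card ∈ H0}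
      ≤ ENNReal.ofReal α := by
  have hs0' : s0 + 1 ≤ n := by omega
  obtain ⟨hα0, hα1⟩ := hα
  set P := (Finset.Icc 1 m).powersetCard t with hP
  set I : ℕ → ENNReal := fun i => ∫⁻ ω, ENNReal.ofReal (hC n m s0 i (S ω)) ∂μ with hI
  set K : ENNReal := ENNReal.ofReal (α * m / t) with hK
  have hSmem : ∀ᵐ ω ∂μ, 𝒮 ω ∈ P := by
    have h : ∀ A : Finset ℕ, ∀ᵐ ω ∂μ, 𝒮 ω = A → A ∈ P := by
      intro A
      by_cases hA : A ∈ P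
      · exact Filter.Eventually.of_forall fun _ _ => hA
      · have h0 := hsub A Set.univ MeasurableSet.univ
        rw [subProb, if_neg hA, zero_mul, Set.preimage_univ, Set.inter_univ] at h0
        rw [ae_iff]
        refine measure_mono_null ?_ h0
        intro ω hω
        simp only [Set.mem_ofPred_eq, Classical.not_imp] at hω ⊢
        exact hω.1
    filter_upwards [ae_all_iff.2 h] with ω hω
    exact hω _ rfl
  have hPc : P.card ≠ 0 := by
    rw [hP, Finset.card_powersetCard, Nat.card_Icc]
    exact (Nat.choose_pos (by omega)).ne'
  have hle : μ {ω | rejSet n m (S ω) (σ' ω) (khatASLCsub n m t s0 α (S ω) (σ' ω)) ≠ ∅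
          ∧ σ ω (rejSet n m (S ω) (σ' ω)
              (khatASLCsub n m t s0 α (S ω) (σ' ω))).card ∈ H0}
      ≤ μ (⋃ A ∈ P, ⋃ i ∈ A ∩ H0, ({ω | 𝒮 ω = A} ∩ S ⁻¹' {s | BndC n m t s0 α A i s})) := by
    apply measure_mono_ae
    filter_upwards [hσ, hσ', hSmem] with ω h1 h2 h3 hω
    obtain ⟨hA, hAt⟩ := Finset.mem_powersetCard.1 h3
    obtain ⟨i, hi, hb⟩ := link n m t s0 α (S ω) (𝒮 ω) H0 hA hAt (σ ω) (σ' ω) h1 h2 hω.1 hω.2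
    refine Set.mem_biUnion h3 (Set.mem_biUnion (Finset.mem_coe.2 hi) ⟨rfl, hb⟩)
  refine hle.trans ?_
  have hstep : ∀ A ∈ P, ∀ i ∈ A ∩ H0,
      μ ({ω | 𝒮 ω = A} ∩ S ⁻¹' {s | BndC n m t s0 α A i s}) ≤ (P.card : ENNReal)⁻¹ * (K * I i) := by
    intro A hA i hi
    rw [hsub A _ (meas_bnd n m t s0 α A i), subProb, if_pos hA]
    rw [Finset.mem_inter] at hi
    gcongr
    exact bnd_prob μ n m t s0 hm α hα0 ht1 hs0' S hS H0 hH0 hexch hdist A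
      (Finset.mem_powersetCard.1 hA).1 i hi.1 hi.2
  calc _ ≤ ∑ A ∈ P, μ (⋃ i ∈ A ∩ H0, ({ω | 𝒮 ω = A} ∩ S ⁻¹' {s | BndC n m t s0 α A i s})) :=
        measure_biUnion_finset_le _ _
    _ ≤ ∑ A ∈ P, ∑ i ∈ A ∩ H0, (P.card : ENNReal)⁻¹ * (K * I i) :=
        Finset.sum_le_sum fun A hA => (measure_biUnion_finset_le _ _).trans
          (Finset.sum_le_sum fun i hi => hstep A hA i hi)
    _ = ∑ i ∈ H0, ((P.filter (fun A => i ∈ A)).card : ENNReal) * ((P.card : ENNReal)⁻¹ * (K * I i)) := by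
        rw [Finset.sum_comm' (t' := H0) (s' := fun i => P.filter (fun A => i ∈ A))]
        · simp only [Finset.sum_const, nsmul_eq_mul]
        · intro A i
          simp only [Finset.mem_inter, Finset.mem_filter]
          tauto
    _ = ∑ i ∈ H0, ENNReal.ofReal α * I i := by
        refine Finset.sum_congr rfl fun i hi => ?_
        have hc := count_sub m t i ht1 (hH0 hi)
        rw [← hP] at hc
        rw [← mul_assoc, ← mul_assoc]
        congr 1
        have hPR : (0 : ℝ) < P.card := by exact_mod_cast Nat.pos_of_ne_zero hPc
        rw [hK, ← ENNReal.ofReal_natCast, ← ENNReal.ofReal_natCast (n := P.card),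
          ← ENNReal.ofReal_inv_of_pos hPR, ← ENNReal.ofReal_mul (by positivity),
          ← ENNReal.ofReal_mul (by positivity)]
        congr 1
        have hcR : (m : ℝ) * ((P.filter (fun A => i ∈ A)).card : ℝ) = t * P.card := by
          exact_mod_cast hc
        have htR : (0 : ℝ) < t := by exact_mod_cast ht1
        field_simp
        linarith
    _ = ENNReal.ofReal α * ∑ i ∈ H0, I i := by rw [Finset.mul_sum]
    _ = ENNReal.ofReal α * ∫⁻ ω, ∑ i ∈ H0, ENNReal.ofReal (hC n m s0 i (S ω)) ∂μ := by
        rw [lintegral_finsetSum (f := fun i ω => ENNReal.ofReal (hC n m s0 i (S ω))) _ (fun i _ => (meas_h n m s0 i).ennreal_ofReal.comp hS)]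
    _ ≤ ENNReal.ofReal α * ∫⁻ _, 1 ∂μ := by
        gcongr with ω
        exact h_total n m s0 H0 hH0 (S ω)
    _ = ENNReal.ofReal α := by simp

end
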